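/- Let s ∈ (0,1), t > 0, E ∈ ℝ, L, C₀ > 0, and let q be a probability density on ℝ that is Lipschitz with constant L and satisfies q(x) ≤ C₀/(1 + (x + E)²) for all x ∈ ℝ. Then the set of functions {(w·F²u) restricted to ℝ \ {0} : u : ℝ → ℝ measurable with ‖u‖ ≤ 1} is totally bounded with respect to the supremum metric on bounded functions on ℝ \ {0}. -/

import Mathlib

open MeasureTheory Real

/-- The transfer operator `F` with parameters `s`, `t` and kernel density `q`:
`(Fu)(x) = (t^{2−s}/|x|^{2−s}) ∫ q(−y − t²/x) u(y) dy` for `x ≠ 0`, and `(Fu)(0) = 0`. -/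
noncomputable def Fop (s t : ℝ) (q u : ℝ → ℝ) : ℝ → ℝ := fun x =>
  if x = 0 then 0
  else (t ^ (2 - s) / |x| ^ (2 - s)) * ∫ y : ℝ, q (-y - t ^ 2 / x) * u y

/-- The weight function `w(x) = 1 + |x|^{2−s}`. -/
noncomputable def wfun (s x : ℝ) : ℝ := 1 + |x| ^ (2 - s)

/-- The weighted supremum norm `‖f‖ = sup_x |f(x)|·w(x)`. -/
noncomputable def xnorm (s : ℝ) (f : ℝ → ℝ) : ℝ := ⨆ x : ℝ, |f x| * wfun s x

/-- `f : ℝ → ℝ` is a probability density. -/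
def IsProbDensity (f : ℝ → ℝ) : Prop :=
  Measurable f ∧ (∀ x, 0 ≤ f x) ∧ (∫ x, f x) = 1

open Filter Topology

/-- A uniformly bounded family of functions which can be sampled at finitely many points up to any
given error is totally bounded for uniform convergence. -/
theorem totallyBounded_of_finite_sampling {α : Type*} {S : Set (UniformFun α ℝ)} {M : ℝ}
    (hM : ∀ f ∈ S, ∀ x, |UniformFun.toFun f x| ≤ M)
    (hS : ∀ ε > 0, ∃ P : Finset α, ∀ x, ∃ p ∈ P, ∀ f ∈ S,
      |UniformFun.toFun f x - UniformFun.toFun f p| ≤ ε) :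
    TotallyBounded S := by
  intro d hd
  obtain ⟨V, hV, hVd⟩ := (UniformFun.hasBasis_uniformity α ℝ).mem_iff.1 hd
  obtain ⟨ε, hε, hεV⟩ := Metric.mem_uniformity_dist.1 hV
  obtain ⟨P, hP⟩ := hS (ε / 4) (by positivity)
  let Φ : UniformFun α ℝ → P → ℤ := fun f p => ⌊UniformFun.toFun f p / (ε / 4)⌋
  have hfin : (Φ '' S).Finite := by
    refine (Set.Finite.pi' (t := fun _ : P => Set.Icc ⌊-M / (ε / 4)⌋ ⌊M / (ε / 4)⌋)
      fun _ => Set.finite_Icc _ _).subset ?_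
    rintro _ ⟨f, hf, rfl⟩ p
    have := abs_le.1 (hM f hf p)
    constructor <;> apply Int.floor_le_floor <;> gcongr <;> linarith
  obtain ⟨T, hTS, hT⟩ := Set.exists_subset_bijOn S Φ
  refine ⟨T, hT.finite_iff_finite.2 hfin, fun f hf => ?_⟩
  obtain ⟨g, hgT, hfg⟩ := hT.surjOn (Set.mem_image_of_mem Φ hf)
  refine Set.mem_iUnion₂.2 ⟨g, hgT, hVd fun x => hεV ?_⟩
  obtain ⟨p, hpP, hp⟩ := hP x
  have h₁ := hp f hf
  have h₂ := hp g (hTS hgT)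
  have h₃ := Int.abs_sub_lt_one_of_floor_eq_floor (congrFun hfg ⟨p, hpP⟩)
  rw [← sub_div, abs_div, abs_of_pos (show 0 < ε / 4 by positivity), div_lt_one (by positivity)]
    at h₃
  rw [Real.dist_eq]
  rw [abs_le] at h₁ h₂
  rw [abs_lt] at h₃ ⊢
  constructor <;> linarith [h₁.1, h₁.2, h₂.1, h₂.2, h₃.1, h₃.2]

/-- A uniformly bounded equicontinuous family of functions with uniform limits at infinity is
totally bounded for uniform convergence. -/
theorem totallyBounded_of_equicontinuous_of_limit {X : Type*} [TopologicalSpace X]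
    {S : Set (UniformFun X ℝ)} {M : ℝ}
    (hM : ∀ f ∈ S, ∀ x, |UniformFun.toFun f x| ≤ M)
    (hc : ∀ x₀, ∀ ε > 0, ∀ᶠ x in 𝓝 x₀, ∀ f ∈ S,
      |UniformFun.toFun f x - UniformFun.toFun f x₀| ≤ ε)
    {c : UniformFun X ℝ → ℝ}
    (hl : ∀ ε > 0, ∀ᶠ x in cocompact X, ∀ f ∈ S, |UniformFun.toFun f x - c f| ≤ ε) :
    TotallyBounded S := by
  classical
  refine totallyBounded_of_finite_sampling hM fun ε hε => ?_
  obtain ⟨K, hK, hKε⟩ := mem_cocompact.1 (hl (ε / 2) (by positivity))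
  obtain ⟨P, -, hP⟩ := hK.elim_nhds_subcover _ fun x _ => hc x ε hε
  have key : ∀ x ∈ K, ∃ p ∈ P, ∀ f ∈ S, |UniformFun.toFun f x - UniformFun.toFun f p| ≤ ε := by
    intro x hx
    simpa using hP hx
  by_cases hne : ∃ x₁, x₁ ∉ K
  · obtain ⟨x₁, hx₁⟩ := hne
    refine ⟨insert x₁ P, fun x => ?_⟩
    by_cases hx : x ∈ K
    · obtain ⟨p, hp, h⟩ := key x hx
      exact ⟨p, Finset.mem_insert_of_mem hp, h⟩
    · refine ⟨x₁, Finset.mem_insert_self _ _, fun f hf => ?_⟩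
      have h₁ := abs_le.1 (hKε hx f hf)
      have h₂ := abs_le.1 (hKε hx₁ f hf)
      rw [abs_le]
      constructor <;> linarith [h₁.1, h₁.2, h₂.1, h₂.2]
  · push Not at hne
    exact ⟨P, fun x => key x (hne x)⟩

/-- Averaging a bounded continuous function vanishing at infinity against an integrable function
yields a function vanishing at infinity. -/
theorem tendsto_integral_mul_cocompact {f k : ℝ → ℝ} {B : ℝ} (hf : Continuous f)
    (hB : ∀ x, |f x| ≤ B) (hf₀ : Tendsto f (cocompact ℝ) (𝓝 0)) (hk : Integrable k) :
    Tendsto (fun z => ∫ y, f (-y - z) * k y) (cocompact ℝ) (𝓝 0) := by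
  have : (cocompact ℝ).IsCountablyGenerated := by
    rw [cocompact_eq_atBot_atTop]; infer_instance
  rw [← integral_zero ℝ ℝ]
  refine tendsto_integral_filter_of_dominated_convergence (fun y => B * |k y|) ?_ ?_
    (hk.abs.const_mul B) ?_
  · exact Eventually.of_forall fun z => (by fun_prop : Continuous fun y => f (-y - z)
      ).aestronglyMeasurable.mul hk.aestronglyMeasurable
  · refine Eventually.of_forall fun z => Eventually.of_forall fun y => ?_
    rw [norm_mul, Real.norm_eq_abs, Real.norm_eq_abs]
    gcongr
    exact hB _
  · refine Eventually.of_forall fun y => ?_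
    have : Tendsto (fun z : ℝ => -y - z) (cocompact ℝ) (cocompact ℝ) :=
      (Homeomorph.subLeft (-y)).isClosedEmbedding.tendsto_cocompact
    simpa using (hf₀.comp this).mul_const (k y)

/-- A perturbation estimate for powers: up to a small multiple of `b ^ p`, the difference of
`a ^ p` and `b ^ p` is controlled by any power `d ^ p` with `|a - b| ≤ d`. -/
theorem exists_abs_rpow_sub_rpow_le {p ε : ℝ} (hp : 0 ≤ p) (hε : 0 < ε) :
    ∃ C, 0 ≤ C ∧ ∀ a b d : ℝ, 0 ≤ a → 0 ≤ b → |a - b| ≤ d →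
      |a ^ p - b ^ p| ≤ ε * b ^ p + C * d ^ p := by
  have hcont : ContinuousAt (fun r : ℝ => r ^ p) 1 :=
    Real.continuousAt_rpow_const _ _ (Or.inl one_ne_zero)
  obtain ⟨η, hη, h⟩ := Metric.continuousAt_iff.1 hcont ε hε
  refine ⟨(1 + 1 / η) ^ p, by positivity, fun a b d ha hb hd => ?_⟩
  have hd₀ : 0 ≤ d := (abs_nonneg _).trans hd
  have hd' := abs_le.1 hd
  rcases lt_or_ge d (η * b) with hlt | hge
  · have hb₀ : 0 < b := by
      rcases hb.eq_or_lt with rfl | h'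
      · simp at hlt; linarith
      · exact h'
    have h₁ : dist (a / b) 1 < η := by
      rw [Real.dist_eq, div_sub_one hb₀.ne', abs_div, abs_of_pos hb₀, div_lt_iff₀ hb₀]
      exact hd.trans_lt hlt
    have h₂ := (h h₁).le
    rw [Real.dist_eq, Real.one_rpow, Real.div_rpow ha hb, div_sub_one (by positivity), abs_div,
      abs_of_pos (show 0 < b ^ p by positivity), div_le_iff₀ (by positivity)] at h₂
    have : 0 ≤ (1 + 1 / η) ^ p * d ^ p := by positivity
    linarith
  · have hbd : b ≤ 1 / η * d := by
      rw [one_div, inv_mul_eq_div, le_div_iff₀ hη]; linarith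
    have h₁ : a ^ p ≤ (1 + 1 / η) ^ p * d ^ p := by
      rw [← Real.mul_rpow (by positivity) hd₀]
      exact Real.rpow_le_rpow ha (by linarith) hp
    have h₂ : b ^ p ≤ (1 + 1 / η) ^ p * d ^ p := by
      rw [← Real.mul_rpow (by positivity) hd₀]
      exact Real.rpow_le_rpow hb (by linarith) hp
    have h₃ : 0 ≤ a ^ p := by positivity
    have h₄ : 0 ≤ b ^ p := by positivity
    have h₅ : 0 ≤ ε * b ^ p := by positivity
    rw [abs_le]
    constructor <;> linarith

theorem one_le_wfun (s x : ℝ) : 1 ≤ wfun s x := by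
  unfold wfun
  linarith [Real.rpow_nonneg (abs_nonneg x) (2 - s)]

theorem wfun_pos (s x : ℝ) : 0 < wfun s x := one_pos.trans_le (one_le_wfun s x)

theorem continuous_wfun {s : ℝ} (hs : s < 2) : Continuous (wfun s) :=
  continuous_const.add (continuous_abs.rpow_const fun _ => Or.inr (by linarith))

theorem rpow_abs_add_le {p : ℝ} (hp : 0 ≤ p) (x y : ℝ) :
    |x + y| ^ p ≤ 2 ^ p * (|x| ^ p + |y| ^ p) := by
  have hx := Real.rpow_nonneg (abs_nonneg x) p
  have hy := Real.rpow_nonneg (abs_nonneg y) p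
  have h2 : (0 : ℝ) < 2 ^ p := by positivity
  have h := abs_add_le x y
  rcases le_total |x| |y| with hxy | hxy
  · calc |x + y| ^ p ≤ (2 * |y|) ^ p := Real.rpow_le_rpow (abs_nonneg _) (by linarith) hp
      _ = 2 ^ p * |y| ^ p := Real.mul_rpow zero_le_two (abs_nonneg _)
      _ ≤ _ := by gcongr; linarith
  · calc |x + y| ^ p ≤ (2 * |x|) ^ p := Real.rpow_le_rpow (abs_nonneg _) (by linarith) hp
      _ = 2 ^ p * |x| ^ p := Real.mul_rpow zero_le_two (abs_nonneg _)
      _ ≤ _ := by gcongr; linarith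

theorem wfun_le_mul_add {s : ℝ} (hs : s < 2) (y z : ℝ) :
    wfun s z ≤ 2 ^ (2 - s) * (wfun s (-y - z) + wfun s y) := by
  have h := rpow_abs_add_le (p := 2 - s) (by linarith) (-(-y - z)) (-y)
  rw [abs_neg, abs_neg, show -(-y - z) + -y = z by ring] at h
  have h2 : (1 : ℝ) ≤ 2 ^ (2 - s) := Real.one_le_rpow one_le_two (by linarith)
  unfold wfun
  linarith

theorem integrable_inv_wfun {s : ℝ} (hs : s < 1) : Integrable fun x => (wfun s x)⁻¹ := by
  have h : Integrable fun x : ℝ => 2 ^ (2 - s) * (1 + ‖x‖) ^ (-(2 - s)) :=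
    (integrable_one_add_norm (by simp; linarith)).const_mul _
  refine h.mono' ((continuous_wfun (by linarith)).measurable.inv.aestronglyMeasurable)
    (Eventually.of_forall fun x => ?_)
  have h₁ : (1 + |x|) ^ (2 - s) ≤ 2 ^ (2 - s) * wfun s x := by
    have := rpow_abs_add_le (p := 2 - s) (by linarith) 1 |x|
    rwa [abs_abs, abs_one, Real.one_rpow, abs_of_nonneg (by positivity)] at this
  rw [Real.norm_eq_abs, Real.norm_eq_abs, abs_inv, abs_of_pos (wfun_pos s x),
    Real.rpow_neg (by positivity), ← div_eq_mul_inv, inv_eq_one_div,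
    div_le_div_iff₀ (wfun_pos s x) (by positivity), one_mul]
  exact h₁

theorem le_mul_inv_wfun {s x a A : ℝ} (h : a * wfun s x ≤ A) : a ≤ A * (wfun s x)⁻¹ := by
  rwa [← div_eq_mul_inv, le_div_iff₀ (wfun_pos s x)]

theorem bound_nonneg_of_abs_mul_wfun_le {s x a A : ℝ} (h : |a| * wfun s x ≤ A) : 0 ≤ A :=
  (mul_nonneg (abs_nonneg a) (wfun_pos s x).le).trans h

theorem abs_le_of_abs_mul_wfun_le {s x a A : ℝ} (h : |a| * wfun s x ≤ A) : |a| ≤ A :=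
  (le_mul_of_one_le_right (abs_nonneg a) (one_le_wfun s x)).trans h

theorem integrable_of_abs_mul_wfun_le {s A : ℝ} (hs : s < 1) {f : ℝ → ℝ} (hf : Measurable f)
    (hA : ∀ x, |f x| * wfun s x ≤ A) : Integrable f :=
  ((integrable_inv_wfun hs).const_mul A).mono' hf.aestronglyMeasurable
    (Eventually.of_forall fun x => le_mul_inv_wfun (hA x))

theorem integrable_comp_mul {s A B : ℝ} (hs : s < 1) {f g : ℝ → ℝ} (hf : Measurable f)
    (hg : Measurable g) (hA : ∀ x, |f x| ≤ A) (hB : ∀ x, |g x| * wfun s x ≤ B)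
    (z : ℝ) : Integrable fun y => f (-y - z) * g y :=
  (integrable_of_abs_mul_wfun_le hs hg hB).bdd_mul
    (hf.comp (measurable_id.neg.sub_const z)).aestronglyMeasurable
    (Eventually.of_forall fun _ => hA _)

/-- The weighted sup-norm is submultiplicative, up to a constant, for correlations. -/
theorem abs_integral_mul_wfun_le {s A B : ℝ} (hs : s < 1) {f g : ℝ → ℝ}
    (hA : ∀ x, |f x| * wfun s x ≤ A) (hB : ∀ x, |g x| * wfun s x ≤ B) (z : ℝ) :
    |∫ y, f (-y - z) * g y| * wfun s z ≤
      2 ^ (2 - s) * A * B * (2 * ∫ x, (wfun s x)⁻¹) := by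
  have hA₀ := bound_nonneg_of_abs_mul_wfun_le (hA 0)
  have hi := integrable_inv_wfun hs
  have hi' : Integrable fun y => (wfun s (-y - z))⁻¹ := by
    convert hi.comp_sub_left (-z) using 4
    ring
  have hI : ∫ y, (wfun s (-y - z))⁻¹ = ∫ x, (wfun s x)⁻¹ := by
    rw [← integral_sub_left_eq_self (fun x => (wfun s x)⁻¹) volume (-z)]
    congr! 4
    ring
  have key := norm_integral_le_of_norm_le (f := fun y => f (-y - z) * g y * wfun s z)
    ((hi.add hi').const_mul (2 ^ (2 - s) * A * B)) (Eventually.of_forall fun y => ?_)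
  · simp only [Pi.add_apply] at key
    rw [integral_mul_const, norm_mul, Real.norm_eq_abs, Real.norm_eq_abs,
      abs_of_pos (wfun_pos s z), integral_const_mul, integral_add hi hi', hI] at key
    linarith
  · have h₁ := le_mul_inv_wfun (hA (-y - z))
    have h₂ := le_mul_inv_wfun (hB y)
    have h₃ := wfun_le_mul_add (s := s) (by linarith) y z
    have w₁ := wfun_pos s (-y - z)
    have w₂ := wfun_pos s y
    have w₃ := wfun_pos s z
    rw [Real.norm_eq_abs, abs_mul, abs_mul, abs_of_pos w₃]
    calc |f (-y - z)| * |g y| * wfun s z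
        ≤ (A * (wfun s (-y - z))⁻¹) * (B * (wfun s y)⁻¹) *
          (2 ^ (2 - s) * (wfun s (-y - z) + wfun s y)) :=
          mul_le_mul (mul_le_mul h₁ h₂ (abs_nonneg _) ((abs_nonneg _).trans h₁)) h₃ w₃.le
            (mul_nonneg ((abs_nonneg _).trans h₁) ((abs_nonneg _).trans h₂))
      _ = _ := by
        simp only [Pi.add_apply]
        field_simp

theorem abs_integral_sub_le {s A B L : ℝ} (hs : s < 1) {f g : ℝ → ℝ} (hf : Measurable f)
    (hg : Measurable g) (hA : ∀ x, |f x| ≤ A) (hlip : ∀ x y, |f x - f y| ≤ L * |x - y|)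
    (hB : ∀ x, |g x| * wfun s x ≤ B) (z z' : ℝ) :
    |(∫ y, f (-y - z) * g y) - ∫ y, f (-y - z') * g y| ≤
      L * |z - z'| * (B * ∫ x, (wfun s x)⁻¹) := by
  rw [← integral_sub (integrable_comp_mul hs hf hg hA hB z)
    (integrable_comp_mul hs hf hg hA hB z'), ← integral_const_mul, ← integral_const_mul]
  refine norm_integral_le_of_norm_le (G := ℝ)
    (((integrable_inv_wfun hs).const_mul B).const_mul _) (Eventually.of_forall fun y => ?_)
  rw [← sub_mul, norm_mul, Real.norm_eq_abs, Real.norm_eq_abs]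
  have h := hlip (-y - z) (-y - z')
  rw [show -y - z - (-y - z') = -(z - z') by ring, abs_neg] at h
  exact mul_le_mul h (le_mul_inv_wfun (hB y)) (abs_nonneg _) ((abs_nonneg _).trans h)

theorem wfun_mul_Fop {s t : ℝ} (ht : 0 < t) (q u : ℝ → ℝ) {x : ℝ} (hx : x ≠ 0) :
    wfun s x * Fop s t q u x =
      (t ^ (2 - s) + |t ^ 2 / x| ^ (2 - s) / t ^ (2 - s)) *
        ∫ y, q (-y - t ^ 2 / x) * u y := by
  have hx' : 0 < |x| ^ (2 - s) := Real.rpow_pos_of_pos (abs_pos.2 hx) _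
  have ht' : 0 < t ^ (2 - s) := Real.rpow_pos_of_pos ht _
  have h : |t ^ 2 / x| ^ (2 - s) = t ^ (2 - s) * t ^ (2 - s) / |x| ^ (2 - s) := by
    rw [abs_div, abs_of_pos (show 0 < t ^ 2 by positivity),
      Real.div_rpow (by positivity) (abs_nonneg x), sq, Real.mul_rpow ht.le ht.le]
  rw [Fop, if_neg hx, wfun, h]
  generalize ∫ y, q (-y - t ^ 2 / x) * u y = I
  field_simp
  ring

theorem add_rpow_div_le_mul_wfun {s τ : ℝ} (hτ : 0 < τ) (z : ℝ) :
    τ + |z| ^ (2 - s) / τ ≤ (τ + 1 / τ) * wfun s z := by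
  have h := Real.rpow_nonneg (abs_nonneg z) (2 - s)
  have h₁ : 0 ≤ 1 / τ + τ * |z| ^ (2 - s) := by positivity
  unfold wfun
  rw [div_eq_mul_one_div]
  linarith

theorem continuous_integral_mul {s A B L : ℝ} (hs : s < 1) {f g : ℝ → ℝ} (hf : Measurable f)
    (hg : Measurable g) (hA : ∀ x, |f x| ≤ A) (hlip : ∀ x y, |f x - f y| ≤ L * |x - y|)
    (hB : ∀ x, |g x| * wfun s x ≤ B) : Continuous fun z => ∫ y, f (-y - z) * g y := by
  refine (LipschitzWith.of_dist_le' (K := L * (B * ∫ x, (wfun s x)⁻¹)) fun z z' => ?_).continuous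
  have := abs_integral_sub_le hs hf hg hA hlip hB z z'
  rw [Real.dist_eq, Real.dist_eq]
  linarith

theorem measurable_Fop {s t A B L : ℝ} (hs : s < 1) {q u : ℝ → ℝ} (hq : Measurable q)
    (hu : Measurable u) (hA : ∀ x, |q x| ≤ A) (hlip : ∀ x y, |q x - q y| ≤ L * |x - y|)
    (hB : ∀ x, |u x| * wfun s x ≤ B) : Measurable (Fop s t q u) := by
  have hcont := continuous_integral_mul hs hq hu hA hlip hB
  unfold Fop
  refine Measurable.ite (measurableSet_singleton 0) measurable_const (Measurable.mul ?_ ?_)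
  · fun_prop
  · exact hcont.measurable.comp (by fun_prop)

theorem rpow_abs_le_one_add_sq {p : ℝ} (hp₀ : 0 ≤ p) (hp : p ≤ 2) (x : ℝ) :
    |x| ^ p ≤ 1 + x ^ 2 := by
  rcases le_total |x| 1 with h | h
  · exact (Real.rpow_le_one (abs_nonneg x) h hp₀).trans (by nlinarith)
  · calc |x| ^ p ≤ |x| ^ (2 : ℝ) := Real.rpow_le_rpow_of_exponent_le h hp
      _ = x ^ 2 := by rw [Real.rpow_two, sq_abs]
      _ ≤ _ := by linarith

theorem tendsto_mul_rpow_abs_cocompact {s C : ℝ} (hs : 0 < s) {q : ℝ → ℝ}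
    (hq₀ : ∀ x, 0 ≤ q x) (hqd : ∀ x, q x * (1 + x ^ 2) ≤ C) :
    Tendsto (fun x => q x * |x| ^ (2 - s)) (cocompact ℝ) (𝓝 0) := by
  have h : Tendsto (fun x : ℝ => C * |x| ^ (-s)) (cocompact ℝ) (𝓝 0) := by
    simpa using ((tendsto_rpow_neg_atTop hs).comp
      (tendsto_norm_cocompact_atTop (E := ℝ))).const_mul C
  refine tendsto_of_tendsto_of_tendsto_of_le_of_le' tendsto_const_nhds h
    (Eventually.of_forall fun x => mul_nonneg (hq₀ x) (by positivity)) ?_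
  filter_upwards [(tendsto_norm_cocompact_atTop (E := ℝ)).eventually_gt_atTop 0] with x hx
  rw [Real.norm_eq_abs] at hx
  rw [show 2 - s = 2 + -s by ring, Real.rpow_add hx, Real.rpow_two, sq_abs, ← mul_assoc]
  have := hqd x
  have := hq₀ x
  gcongr
  linarith

theorem tendsto_inv_one_add_abs_cocompact :
    Tendsto (fun x : ℝ => (1 + |x|)⁻¹) (cocompact ℝ) (𝓝 0) :=
  tendsto_inv_atTop_zero.comp
    (tendsto_atTop_add_const_left _ 1 (tendsto_norm_cocompact_atTop (E := ℝ)))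

/-- If `|y| ^ (2 - s) * g y` tends to `c` at infinity with an explicit rate, then so does
`|z| ^ (2 - s) * ∫ q (-y - z) g y`, uniformly in `g`. -/
theorem eventually_abs_rpow_mul_integral_sub_le {s C m D : ℝ} (hs : s ∈ Set.Ioo (0 : ℝ) 1)
    (hm : 0 ≤ m) {q : ℝ → ℝ} (hqc : Continuous q)
    (hq₀ : ∀ x, 0 ≤ q x) (hqi : ∫ x, q x = 1) (hqd : ∀ x, q x * (1 + x ^ 2) ≤ C)
    {ε : ℝ} (hε : 0 < ε) :
    ∀ᶠ z in cocompact ℝ, ∀ (g : ℝ → ℝ) (c : ℝ), Measurable g → (∀ y, |g y| * wfun s y ≤ m) →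
      (∀ y, |(|y| ^ (2 - s) * g y - c)| * (1 + |y|) ≤ D) →
      |(|z| ^ (2 - s) * ∫ y, q (-y - z) * g y) - c| ≤ ε := by
  obtain ⟨hs₀, hs₁⟩ := hs
  have hqint : Integrable q := integrable_of_integral_eq_one hqi
  have hqC : ∀ x, |q x| ≤ C := fun x => by
    rw [abs_of_nonneg (hq₀ x)]
    exact (le_mul_of_one_le_right (hq₀ x) (by nlinarith)).trans (hqd x)
  obtain ⟨K, hK, hKb⟩ := exists_abs_rpow_sub_rpow_le (p := 2 - s) (ε := ε / (2 * (m + 1)))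
    (by linarith) (by positivity)
  have hφc : Continuous fun x => q x * |x| ^ (2 - s) :=
    hqc.mul (continuous_abs.rpow_const fun _ => Or.inr (by linarith))
  have hφb : ∀ x, |q x * |x| ^ (2 - s)| ≤ C := fun x => by
    rw [abs_of_nonneg (mul_nonneg (hq₀ x) (by positivity))]
    exact (mul_le_mul_of_nonneg_left
      (rpow_abs_le_one_add_sq (by linarith) (by linarith) x) (hq₀ x)).trans (hqd x)
  have hψc : Continuous fun x : ℝ => (1 + |x|)⁻¹ :=
    (by fun_prop : Continuous fun x : ℝ => 1 + |x|).inv₀ fun x => by positivity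
  have hψb : ∀ x : ℝ, |(1 + |x|)⁻¹| ≤ 1 := fun x => by
    rw [abs_of_nonneg (by positivity)]
    exact inv_le_one_of_one_le₀ (by linarith [abs_nonneg x])
  have hw := integrable_inv_wfun hs₁
  have h₁ := (tendsto_integral_mul_cocompact hφc hφb
    (tendsto_mul_rpow_abs_cocompact hs₀ hq₀ hqd) hw).const_mul (K * m)
  have h₂ := (tendsto_integral_mul_cocompact hψc hψb
    tendsto_inv_one_add_abs_cocompact hqint).const_mul D
  have h₃ := h₁.add h₂
  rw [mul_zero, mul_zero, add_zero] at h₃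
  filter_upwards [h₃.eventually_lt_const (half_pos hε)] with z hz g c hg hgm hgc
  have hqz : Integrable fun y => q (-y - z) := by
    convert hqint.comp_sub_left (-z) using 3
    ring
  have hqz₁ : ∫ y, q (-y - z) = 1 := by
    rw [← hqi, ← integral_sub_left_eq_self q volume (-z)]
    congr! 3
    ring
  have hψ : ∫ y, q (-y - z) * (1 + |y|)⁻¹ = ∫ y, (1 + |(-y - z)|)⁻¹ * q y := by
    rw [← integral_sub_left_eq_self (fun y => q (-y - z) * (1 + |y|)⁻¹) volume (-z)]
    refine integral_congr_ae (Eventually.of_forall fun y => ?_)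
    simp only
    rw [show -(-z - y) - z = y by ring, show -z - y = -y - z by ring, mul_comm]
  have hi₁ : Integrable fun y => q (-y - z) * g y :=
    integrable_comp_mul hs₁ hqc.measurable hg hqC hgm z
  have hi₂ : Integrable fun y => q (-y - z) * |(-y - z)| ^ (2 - s) * (wfun s y)⁻¹ :=
    hw.bdd_mul (hφc.comp (by fun_prop : Continuous fun y => -y - z)).aestronglyMeasurable
      (Eventually.of_forall fun y => hφb (-y - z))
  have hi₃ : Integrable fun y => q (-y - z) * (1 + |y|)⁻¹ :=
    hqz.mul_bdd hψc.aestronglyMeasurable (Eventually.of_forall hψb)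
  have heq : |z| ^ (2 - s) * (∫ y, q (-y - z) * g y) - c =
      ∫ y, q (-y - z) * (|z| ^ (2 - s) * g y - c) := by
    have : ∀ y, q (-y - z) * (|z| ^ (2 - s) * g y - c) =
      |z| ^ (2 - s) * (q (-y - z) * g y) - c * q (-y - z) := fun y => by ring
    simp_rw [this]
    rw [integral_sub (hi₁.const_mul _) (hqz.const_mul _), integral_const_mul,
      integral_const_mul, hqz₁, mul_one]
  rw [heq]
  have key := norm_integral_le_of_norm_le (f := fun y => q (-y - z) * (|z| ^ (2 - s) * g y - c))
    (((hqz.const_mul (ε / (2 * (m + 1)) * m)).add (hi₂.const_mul (K * m))).add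
      (hi₃.const_mul D)) (Eventually.of_forall fun y => ?_)
  · rw [integral_add' ((hqz.const_mul _).add (hi₂.const_mul _)) (hi₃.const_mul _),
      integral_add' (hqz.const_mul _) (hi₂.const_mul _), integral_const_mul, integral_const_mul,
      integral_const_mul, hqz₁, hψ, mul_one] at key
    have hm' : ε / (2 * (m + 1)) * m ≤ ε / 2 := by
      rw [div_mul_eq_mul_div, div_le_div_iff₀ (by positivity) two_pos]
      nlinarith
    exact key.trans (by linarith)
  · have hd : |(|z| - |y|)| ≤ |(-y - z)| := by
      have := abs_abs_sub_abs_le_abs_sub z (-y)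
      rwa [abs_neg, show z - -y = -(-y - z) by ring, abs_neg] at this
    have b₁ := hKb |z| |y| _ (abs_nonneg z) (abs_nonneg y) hd
    have b₂ := le_mul_inv_wfun (hgm y)
    have b₃ : |(|y| ^ (2 - s) * g y - c)| ≤ D * (1 + |y|)⁻¹ := by
      rw [← div_eq_mul_inv, le_div_iff₀ (by positivity)]; exact hgc y
    have b₄ : |y| ^ (2 - s) * |g y| ≤ m := by
      refine le_trans ?_ (hgm y)
      rw [mul_comm, wfun]
      gcongr
      linarith
    have hp : 0 ≤ |(-y - z)| ^ (2 - s) := by positivity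
    have hsplit : |z| ^ (2 - s) * g y - c =
      (|z| ^ (2 - s) - |y| ^ (2 - s)) * g y + (|y| ^ (2 - s) * g y - c) := by ring
    have b₅ : |(|z| ^ (2 - s) * g y - c)| ≤ ε / (2 * (m + 1)) * m +
        K * |(-y - z)| ^ (2 - s) * (m * (wfun s y)⁻¹) + D * (1 + |y|)⁻¹ := by
      rw [hsplit]
      refine (abs_add_le _ _).trans (add_le_add ?_ b₃)
      rw [abs_mul]
      calc _ ≤ (ε / (2 * (m + 1)) * |y| ^ (2 - s) + K * |(-y - z)| ^ (2 - s)) * |g y| := by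
            gcongr
        _ = ε / (2 * (m + 1)) * (|y| ^ (2 - s) * |g y|) + K * |(-y - z)| ^ (2 - s) * |g y| := by
            ring
        _ ≤ _ := by gcongr
    rw [norm_mul, Real.norm_eq_abs, Real.norm_eq_abs, abs_of_nonneg (hq₀ _)]
    refine (mul_le_mul_of_nonneg_left b₅ (hq₀ _)).trans_eq ?_
    simp only [Pi.add_apply]
    ring

theorem tendsto_wfun_cocompact {s : ℝ} (hs : s < 2) : Tendsto (wfun s) (cocompact ℝ) atTop :=
  tendsto_atTop_add_const_left _ 1
    ((tendsto_rpow_atTop (by linarith : 0 < 2 - s)).comp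
      (tendsto_norm_cocompact_atTop (E := ℝ)))

theorem mul_one_add_sq_le_of_le_div {E C₀ : ℝ} (hC₀ : 0 ≤ C₀) {q : ℝ → ℝ}
    (hupp : ∀ x, q x ≤ C₀ / (1 + (x + E) ^ 2)) (x : ℝ) :
    q x * (1 + x ^ 2) ≤ C₀ * (2 * (1 + E ^ 2)) := by
  have h : 1 + x ^ 2 ≤ 2 * (1 + E ^ 2) * (1 + (x + E) ^ 2) := by
    nlinarith [sq_nonneg (x + 2 * E), sq_nonneg (E * (x + E)), sq_nonneg (x + E)]
  calc q x * (1 + x ^ 2) ≤ C₀ / (1 + (x + E) ^ 2) * (1 + x ^ 2) := by gcongr; exact hupp x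
    _ ≤ C₀ / (1 + (x + E) ^ 2) * (2 * (1 + E ^ 2) * (1 + (x + E) ^ 2)) := by gcongr
    _ = _ := by field_simp

theorem abs_Fop_mul_wfun_le {s t m : ℝ} (ht : 0 < t) {q u : ℝ → ℝ}
    (hm : ∀ z, |∫ y, q (-y - z) * u y| * wfun s z ≤ m) (x : ℝ) :
    |Fop s t q u x| * wfun s x ≤ (t ^ (2 - s) + 1 / t ^ (2 - s)) * m := by
  have hτ : 0 < t ^ (2 - s) := Real.rpow_pos_of_pos ht _
  have hm₀ := bound_nonneg_of_abs_mul_wfun_le (hm 0)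
  rcases eq_or_ne x 0 with rfl | hx
  · rw [Fop, if_pos rfl, abs_zero, zero_mul]
    positivity
  · rw [← abs_of_pos (wfun_pos s x), ← abs_mul, mul_comm, wfun_mul_Fop ht q u hx, abs_mul,
      abs_of_nonneg (by positivity)]
    calc _ ≤ (t ^ (2 - s) + 1 / t ^ (2 - s)) * wfun s (t ^ 2 / x) *
          |∫ y, q (-y - t ^ 2 / x) * u y| := by
          gcongr
          exact add_rpow_div_le_mul_wfun hτ _
      _ = (t ^ (2 - s) + 1 / t ^ (2 - s)) *
          (|∫ y, q (-y - t ^ 2 / x) * u y| * wfun s (t ^ 2 / x)) := by ring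
      _ ≤ _ := by gcongr; exact hm _

theorem abs_rpow_mul_Fop_sub_mul_one_add_abs_le {s t m K : ℝ} (ht : 0 < t) {q u : ℝ → ℝ}
    (hm : ∀ z, |∫ y, q (-y - z) * u y| * wfun s z ≤ m)
    (hK : ∀ z z', |(∫ y, q (-y - z) * u y) - ∫ y, q (-y - z') * u y| ≤ K * |z - z'|) (x : ℝ) :
    |(|x| ^ (2 - s) * Fop s t q u x - t ^ (2 - s) * ∫ y, q (-y - 0) * u y)| * (1 + |x|) ≤
      (t ^ (2 - s) + 1 / t ^ (2 - s)) * m + t ^ (2 - s) * m + t ^ (2 - s) * (K * t ^ 2) := by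
  have hτ : 0 < t ^ (2 - s) := Real.rpow_pos_of_pos ht _
  have hK₀ : 0 ≤ K := by simpa using (abs_nonneg _).trans (hK 1 0)
  have h₁ : |(|x| ^ (2 - s) * Fop s t q u x - t ^ (2 - s) * ∫ y, q (-y - 0) * u y)| ≤
      (t ^ (2 - s) + 1 / t ^ (2 - s)) * m + t ^ (2 - s) * m := by
    refine (abs_sub _ _).trans (add_le_add ?_ ?_)
    · refine le_trans ?_ (abs_Fop_mul_wfun_le ht hm x)
      rw [abs_mul, mul_comm, abs_of_nonneg (Real.rpow_nonneg (abs_nonneg x) _), wfun]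
      exact mul_le_mul_of_nonneg_left (by linarith) (abs_nonneg _)
    · rw [abs_mul, abs_of_pos hτ]
      gcongr
      exact abs_le_of_abs_mul_wfun_le (hm 0)
  have h₂ : |(|x| ^ (2 - s) * Fop s t q u x - t ^ (2 - s) * ∫ y, q (-y - 0) * u y)| * |x| ≤
      t ^ (2 - s) * (K * t ^ 2) := by
    rcases eq_or_ne x 0 with rfl | hx
    · rw [abs_zero, mul_zero]
      positivity
    · have hx' : 0 < |x| := abs_pos.2 hx
      have hxp : 0 < |x| ^ (2 - s) := Real.rpow_pos_of_pos hx' _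
      have h := hK (t ^ 2 / x) 0
      rw [sub_zero, abs_div, abs_of_pos (show 0 < t ^ 2 by positivity)] at h
      rw [Fop, if_neg hx, ← mul_assoc, mul_div_cancel₀ _ hxp.ne', ← mul_sub, abs_mul,
        abs_of_pos hτ, mul_assoc]
      refine mul_le_mul_of_nonneg_left ?_ hτ.le
      calc _ ≤ K * (t ^ 2 / |x|) * |x| := by gcongr
        _ = _ := by field_simp
  linarith

/-- Let `s ∈ (0,1)`, `t > 0`, `E ∈ ℝ`, `L, C₀ > 0`, and let `q` be a
probability density, Lipschitz with constant `L`, with `q(x) ≤ C₀/(1 + (x + E)²)`.  Then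
the set of functions `{(w·F²u)|_{ℝ \ {0}} : u measurable, ‖u‖ ≤ 1}` is totally bounded for
the uniformity of uniform convergence (i.e. the supremum metric) on functions on
`ℝ \ {0}`. -/
theorem stmt12 (s t E L C₀ : ℝ) (hs : s ∈ Set.Ioo (0 : ℝ) 1) (ht : 0 < t)
    (hL : 0 < L) (hC₀ : 0 < C₀)
    (q : ℝ → ℝ) (hq : IsProbDensity q) (hlip : ∀ x y : ℝ, |q x - q y| ≤ L * |x - y|)
    (hupp : ∀ x, q x ≤ C₀ / (1 + (x + E) ^ 2)) :
    TotallyBounded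
      {F : UniformFun {x : ℝ // x ≠ 0} ℝ |
        ∃ u : ℝ → ℝ, Measurable u ∧ (∀ x, |u x| * wfun s x ≤ 1) ∧
          F = UniformFun.ofFun fun x : {x : ℝ // x ≠ 0} =>
            wfun s x.1 * Fop s t q (Fop s t q u) x.1} := by

  obtain ⟨hs₀, hs₁⟩ := hs
  obtain ⟨hqm, hq₀, hqi⟩ := hq
  have hqd := mul_one_add_sq_le_of_le_div hC₀.le hupp
  set C := C₀ * (2 * (1 + E ^ 2))
  have hqc : Continuous q :=
    (LipschitzWith.of_dist_le' (K := L) fun x y => by simpa [Real.dist_eq] using hlip x y).continuous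
  have hqw : ∀ x, |q x| * wfun s x ≤ 2 * C := fun x => by
    have h := rpow_abs_le_one_add_sq (p := 2 - s) (by linarith) (by linarith) x
    rw [abs_of_nonneg (hq₀ x)]
    have : wfun s x ≤ 2 * (1 + x ^ 2) := by unfold wfun; nlinarith
    calc q x * wfun s x ≤ q x * (2 * (1 + x ^ 2)) := mul_le_mul_of_nonneg_left this (hq₀ x)
      _ ≤ _ := by linarith [hqd x]
  have hqb : ∀ x, |q x| ≤ 2 * C := fun x => abs_le_of_abs_mul_wfun_le (hqw x)
  have hτ : 0 < t ^ (2 - s) := Real.rpow_pos_of_pos ht _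
  set τ := t ^ (2 - s)
  set J := ∫ x, (wfun s x)⁻¹
  set U := {u : ℝ → ℝ | Measurable u ∧ ∀ x, |u x| * wfun s x ≤ 1}
  let G : (ℝ → ℝ) → ℝ → ℝ := fun u z => ∫ y, q (-y - z) * u y
  obtain ⟨m, hGm⟩ : ∃ m, ∀ u ∈ U, ∀ z, |G u z| * wfun s z ≤ m :=
    ⟨_, fun u hu => abs_integral_mul_wfun_le hs₁ hqw hu.2⟩
  have hm : 0 ≤ m := bound_nonneg_of_abs_mul_wfun_le (hGm 0 ⟨measurable_const, by simp⟩ 0)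
  obtain ⟨m', hm', hFm⟩ : ∃ m', 0 ≤ m' ∧ ∀ u ∈ U, ∀ x, |Fop s t q u x| * wfun s x ≤ m' :=
    ⟨_, by positivity, fun u hu => abs_Fop_mul_wfun_le ht (hGm u hu)⟩
  have hFmeas : ∀ u ∈ U, Measurable (Fop s t q u) := fun u hu =>
    measurable_Fop hs₁ hqm hu.1 hqb hlip hu.2
  obtain ⟨D, hD⟩ : ∃ D, ∀ u ∈ U, ∀ x,
      |(|x| ^ (2 - s) * Fop s t q u x - τ * G u 0)| * (1 + |x|) ≤ D :=
    ⟨_, fun u hu => abs_rpow_mul_Fop_sub_mul_one_add_abs_le (K := L * (1 * J)) ht (hGm u hu)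
      fun z z' => (abs_integral_sub_le hs₁ hqm hu.1 hqb hlip hu.2 z z').trans_eq (by ring)⟩
  obtain ⟨B, hGB⟩ : ∃ B, ∀ u ∈ U, ∀ z, |G (Fop s t q u) z| * wfun s z ≤ B :=
    ⟨_, fun u hu => abs_integral_mul_wfun_le hs₁ hqw (hFm u hu)⟩
  have hB : 0 ≤ B := bound_nonneg_of_abs_mul_wfun_le (hGB 0 ⟨measurable_const, by simp⟩ 0)
  let a : ℝ → ℝ := fun z => τ + |z| ^ (2 - s) / τ
  have ha₀ : ∀ z, 0 ≤ a z := fun z => by positivity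
  have hac : Continuous a := continuous_const.add
    ((continuous_abs.rpow_const fun _ => Or.inr (by linarith)).div_const _)
  let h : (ℝ → ℝ) → UniformFun ℝ ℝ := fun u => UniformFun.ofFun fun z => a z * G (Fop s t q u) z
  have hTB : TotallyBounded (h '' U) := by
    choose! v hvU hv using fun f (hf : f ∈ h '' U) => hf
    refine totallyBounded_of_equicontinuous_of_limit (M := (τ + 1 / τ) * B)
      (c := fun f => G (v f) 0) ?_ ?_ ?_
    · rintro _ ⟨u, hu, rfl⟩ z
      change |a z * G (Fop s t q u) z| ≤ _
      rw [abs_mul, abs_of_nonneg (ha₀ z)]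
      calc _ ≤ (τ + 1 / τ) * wfun s z * |G (Fop s t q u) z| := by
            gcongr
            exact add_rpow_div_le_mul_wfun hτ z
        _ = (τ + 1 / τ) * (|G (Fop s t q u) z| * wfun s z) := by ring
        _ ≤ _ := by gcongr; exact hGB u hu z
    · intro z₀ ε hε
      have hcont : Continuous fun z => a z * (L * |z - z₀| * (m' * J)) + |a z - a z₀| * B := by
        fun_prop
      have hev := hcont.continuousAt.eventually_lt (x₀ := z₀) continuousAt_const
        (show _ < ε by simpa using hε)
      filter_upwards [hev] with z hz
      rintro _ ⟨u, hu, rfl⟩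
      change |a z * G (Fop s t q u) z - a z₀ * G (Fop s t q u) z₀| ≤ ε
      have h₁ := abs_integral_sub_le hs₁ hqm (hFmeas u hu) hqb hlip (hFm u hu) z z₀
      have h₂ := abs_le_of_abs_mul_wfun_le (hGB u hu z₀)
      rw [show a z * G (Fop s t q u) z - a z₀ * G (Fop s t q u) z₀ =
        a z * (G (Fop s t q u) z - G (Fop s t q u) z₀) + (a z - a z₀) * G (Fop s t q u) z₀ by ring]
      refine (abs_add_le _ _).trans (le_trans (add_le_add ?_ ?_) hz.le)
      · rw [abs_mul, abs_of_nonneg (ha₀ z)]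
        exact mul_le_mul_of_nonneg_left h₁ (ha₀ z)
      · rw [abs_mul]
        gcongr
    · intro ε hε
      filter_upwards [eventually_abs_rpow_mul_integral_sub_le (D := D) ⟨hs₀, hs₁⟩ hm' hqc hq₀ hqi
        hqd (show 0 < ε / 2 * τ by positivity),
        (tendsto_wfun_cocompact (show s < 2 by linarith)).eventually_ge_atTop (τ * B * (2 / ε))]
        with z hz₁ hz₂ f hf
      have hu := hvU f hf
      have hval : UniformFun.toFun f z - G (v f) 0 = τ * G (Fop s t q (v f)) z +
          (|z| ^ (2 - s) * G (Fop s t q (v f)) z - τ * G (v f) 0) / τ := by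
        rw [← congrArg (fun f => UniformFun.toFun f z) (hv f hf)]
        change (τ + |z| ^ (2 - s) / τ) * G (Fop s t q (v f)) z - G (v f) 0 = _
        field_simp
        ring
      have h₁ := hz₁ (Fop s t q (v f)) (τ * G (v f) 0) (hFmeas _ hu) (hFm _ hu) (hD _ hu)
      have h₂ : τ * |G (Fop s t q (v f)) z| ≤ ε / 2 := by
        have hw := wfun_pos s z
        have h₃ : |G (Fop s t q (v f)) z| ≤ B / wfun s z := by
          rw [le_div_iff₀ hw]
          exact hGB _ hu z
        calc _ ≤ τ * (B / wfun s z) := by gcongr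
          _ ≤ ε / 2 := by
            rw [← mul_div_assoc, div_le_iff₀ hw]
            calc τ * B = ε / 2 * (τ * B * (2 / ε)) := by field_simp
              _ ≤ _ := by gcongr
      rw [hval]
      refine (abs_add_le _ _).trans ((add_le_add ?_ ?_).trans_eq (add_halves ε))
      · rwa [abs_mul, abs_of_pos hτ]
      · rwa [abs_div, abs_of_pos hτ, div_le_iff₀ hτ]
  refine (hTB.image (UniformFun.precomp_uniformContinuous
    (f := fun x : {x : ℝ // x ≠ 0} => t ^ 2 / x.1))).subset ?_
  rintro _ ⟨u, hum, hu, rfl⟩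
  refine ⟨_, ⟨u, ⟨hum, hu⟩, rfl⟩, ?_⟩
  refine congrArg UniformFun.ofFun (funext fun x => ?_)
  exact (wfun_mul_Fop ht q (Fop s t q u) x.2).symm
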